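/- γ_3 ≥ 3/2, where γ_3 = sup{K/α : there exists a (3,K,α) prefix covering design}. This follows since for every g ≥ 1 there is a (3, 3g, 2g+1) prefix covering design, and 3g/(2g+1) → 3/2 as g → ∞. -/

import Mathlib

open scoped BigOperators

/-- `x` occurs at 1-indexed level `ℓ` in some sequence of `s`. -/
def OccursAt {d K : ℕ} (s : Fin d → List (Fin K)) (x : Fin K) (ℓ : ℕ) : Prop :=
  1 ≤ ℓ ∧ ∃ i : Fin d, (s i)[ℓ - 1]? = some x

/-- `ℓ_min(x)`: the minimal 1-indexed level at which `x` occurs in any sequence. -/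
noncomputable def lMin {d K : ℕ} (s : Fin d → List (Fin K)) (x : Fin K) : ℕ :=
  sInf {ℓ | OccursAt s x ℓ}

/-- `ℓ_max(x)`: the maximal 1-indexed level at which `x` occurs in any sequence. -/
noncomputable def lMax {d K : ℕ} (s : Fin d → List (Fin K)) (x : Fin K) : ℕ :=
  sSup {ℓ | OccursAt s x ℓ}

/-- Total number of occurrences of `x` among the sequences. -/
def totalCount {d K : ℕ} (s : Fin d → List (Fin K)) (x : Fin K) : ℕ :=
  ∑ i : Fin d, (s i).count x

/-- Triplet condition: every 3-element subset of `[K]` is covered by at most three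
prefixes of total length at most `α`. -/
def TripletCond (d K α : ℕ) (s : Fin d → List (Fin K)) : Prop :=
  ∀ a b c : Fin K, a ≠ b → a ≠ c → b ≠ c →
    ∃ (i i' i'' : Fin d) (ℓ ℓ' ℓ'' : ℕ), ℓ + ℓ' + ℓ'' ≤ α ∧
      ∀ x : Fin K, (x = a ∨ x = b ∨ x = c) →
        x ∈ (s i).take ℓ ∨ x ∈ (s i').take ℓ' ∨ x ∈ (s i'').take ℓ''

/-- Singleton condition: `ℓ_min(x) + ℓ_max(x) ≤ α + 1` for every repeated element `x`. -/
def SingletonCond (d K α : ℕ) (s : Fin d → List (Fin K)) : Prop :=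
  ∀ x : Fin K, 2 ≤ totalCount s x → lMin s x + lMax s x ≤ α + 1

/-- A `(d, K, α)` prefix covering design. -/
def IsPCD (d K α : ℕ) (s : Fin d → List (Fin K)) : Prop :=
  TripletCond d K α s ∧ SingletonCond d K α s

/-- A convenient embedding of a doubly-indexed element into `Fin N`. -/
def pcdElem (off a b N : ℕ) (h : off + a * b ≤ N) (i : Fin a) (t : Fin b) : Fin N :=
  ⟨off + (i.1 * b + t.1), by
    have hi := i.isLt
    have ht := t.isLt
    have h2 : i.1 * b + t.1 < a * b := by
      calc i.1 * b + t.1 < i.1 * b + b := by omega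
        _ = (i.1 + 1) * b := (Nat.succ_mul _ _).symm
        _ ≤ a * b := Nat.mul_le_mul_right _ hi
    omega⟩

/-- A `(v, k, 2)` covering design with `d` blocks. -/
def IsCoveringDesign (v k d : ℕ) (B : Fin d → Finset (Fin v)) : Prop :=
  (∀ i, (B i).card = k) ∧ ∀ x y : Fin v, x ≠ y → ∃ i, x ∈ B i ∧ y ∈ B i

/-- The set of qualities `K/α` of `(d, K, α)` prefix covering designs; `γ_d` is its supremum. -/
def gammaSet (d : ℕ) : Set ℝ :=
  {q | ∃ (K α : ℕ) (s : Fin d → List (Fin K)),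
    4 ≤ K ∧ 0 < α ∧ IsPCD d K α s ∧ q = (K : ℝ) / (α : ℝ)}

/-- The sequence `A_i` followed by the reversal of `A_{i-1}`, where `A_r` lists the elements
congruent to `r` modulo `3` in increasing order. -/
def foldedSeq (g : ℕ) (i : Fin 3) : List (Fin (3 * g)) :=
  List.ofFn fun n : Fin (2 * g) =>
    if h : n.1 < g then ⟨3 * n.1 + i.1, by omega⟩
    else ⟨3 * (2 * g - 1 - n.1) + (i.1 + 2) % 3, by omega⟩

theorem mem_take_foldedSeq_of_div_lt {g ℓ : ℕ} (x : Fin (3 * g)) (i : Fin 3)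
    (hi : x.1 % 3 = i.1) (h : x.1 / 3 < ℓ) : x ∈ (foldedSeq g i).take ℓ := by
  have hx := x.2
  rw [List.mem_take_iff_getElem]
  refine ⟨x.1 / 3, by simp only [foldedSeq, List.length_ofFn]; omega, ?_⟩
  simp only [foldedSeq, List.getElem_ofFn]
  rw [dif_pos (by omega)]
  ext
  simp only
  omega

theorem mem_take_foldedSeq_of_le_add {g ℓ : ℕ} (x : Fin (3 * g)) (i : Fin 3)
    (hi : (x.1 + 1) % 3 = i.1) (h : 2 * g ≤ x.1 / 3 + ℓ) : x ∈ (foldedSeq g i).take ℓ := by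
  have hx := x.2
  rw [List.mem_take_iff_getElem]
  refine ⟨2 * g - 1 - x.1 / 3, by simp only [foldedSeq, List.length_ofFn]; omega, ?_⟩
  simp only [foldedSeq, List.getElem_ofFn]
  rw [dif_neg (by omega)]
  ext
  simp only
  omega

theorem eq_or_eq_of_occursAt_foldedSeq {g ℓ : ℕ} {x : Fin (3 * g)}
    (h : OccursAt (foldedSeq g) x ℓ) : ℓ = x.1 / 3 + 1 ∨ ℓ = 2 * g - x.1 / 3 := by
  obtain ⟨hℓ, i, hi⟩ := h
  obtain ⟨hlt, hx⟩ := List.getElem?_eq_some_iff.1 hi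
  have hlt' : ℓ - 1 < 2 * g := by simpa only [foldedSeq, List.length_ofFn] using hlt
  simp only [foldedSeq, List.getElem_ofFn] at hx
  have := i.2
  split_ifs at hx <;> subst hx <;> simp only <;> omega

theorem occursAt_foldedSeq {g : ℕ} (x : Fin (3 * g)) :
    OccursAt (foldedSeq g) x (x.1 / 3 + 1) := by
  have hx := x.2
  refine ⟨by omega, ⟨x.1 % 3, by omega⟩, List.getElem?_eq_some_iff.2
    ⟨by simp only [foldedSeq, List.length_ofFn]; omega, ?_⟩⟩
  simp only [foldedSeq, List.getElem_ofFn]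
  rw [dif_pos (by omega)]
  ext
  simp only
  omega

theorem singletonCond_foldedSeq (g : ℕ) :
    SingletonCond 3 (3 * g) (2 * g + 1) (foldedSeq g) := by
  intro x _
  have hx := x.2
  have hmin : lMin (foldedSeq g) x ≤ x.1 / 3 + 1 := Nat.sInf_le (occursAt_foldedSeq x)
  have hmax : lMax (foldedSeq g) x ≤ 2 * g - x.1 / 3 := by
    refine csSup_le ⟨_, occursAt_foldedSeq x⟩ fun ℓ hℓ => ?_
    rcases eq_or_eq_of_occursAt_foldedSeq hℓ with h | h <;> omega
  omega

/-- Three prefixes of `s` of total length at most `α` cover `a`, `b` and `c`. -/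
def TripleCovered {d K : ℕ} (s : Fin d → List (Fin K)) (α : ℕ) (a b c : Fin K) : Prop :=
  ∃ (i i' i'' : Fin d) (ℓ ℓ' ℓ'' : ℕ), ℓ + ℓ' + ℓ'' ≤ α ∧
    ∀ x : Fin K, (x = a ∨ x = b ∨ x = c) →
      x ∈ (s i).take ℓ ∨ x ∈ (s i').take ℓ' ∨ x ∈ (s i'').take ℓ''

theorem TripleCovered.rotate {d K α : ℕ} {s : Fin d → List (Fin K)} {a b c : Fin K}
    (h : TripleCovered s α a b c) : TripleCovered s α b c a := by
  obtain ⟨i, i', i'', ℓ, ℓ', ℓ'', hα, hx⟩ := h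
  exact ⟨i, i', i'', ℓ, ℓ', ℓ'', hα, fun x h => hx x (by tauto)⟩

theorem TripleCovered.swap {d K α : ℕ} {s : Fin d → List (Fin K)} {a b c : Fin K}
    (h : TripleCovered s α a b c) : TripleCovered s α a c b := by
  obtain ⟨i, i', i'', ℓ, ℓ', ℓ'', hα, hx⟩ := h
  exact ⟨i, i', i'', ℓ, ℓ', ℓ'', hα, fun x h => hx x (by tauto)⟩

theorem tripleCovered_foldedSeq_of_mod_eq {g : ℕ} (a b c : Fin (3 * g))
    (h : a.1 % 3 = b.1 % 3) : TripleCovered (foldedSeq g) (2 * g + 1) a b c := by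
  have ha := a.2
  have hb := b.2
  have hc := c.2
  refine ⟨⟨a.1 % 3, by omega⟩, ⟨c.1 % 3, by omega⟩, 0, g, g, 0, by omega, ?_⟩
  rintro x (rfl | rfl | rfl)
  · exact .inl (mem_take_foldedSeq_of_div_lt _ _ rfl (by omega))
  · exact .inl (mem_take_foldedSeq_of_div_lt _ _ h.symm (by omega))
  · exact .inr (.inl (mem_take_foldedSeq_of_div_lt _ _ rfl (by omega)))

theorem tripleCovered_foldedSeq_of_div_le {g : ℕ} (a b c : Fin (3 * g))
    (hb : b.1 % 3 = (a.1 + 1) % 3) (hca : c.1 / 3 ≤ a.1 / 3) :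
    TripleCovered (foldedSeq g) (2 * g + 1) a b c := by
  have ha := a.2
  have hb' := b.2
  refine ⟨⟨(a.1 + 1) % 3, by omega⟩, ⟨c.1 % 3, by omega⟩, 0,
    2 * g - a.1 / 3, c.1 / 3 + 1, 0, by omega, ?_⟩
  rintro x (rfl | rfl | rfl)
  · exact .inl (mem_take_foldedSeq_of_le_add _ _ rfl (by omega))
  · exact .inl (mem_take_foldedSeq_of_div_lt _ _ hb (by omega))
  · exact .inr (.inl (mem_take_foldedSeq_of_div_lt _ _ rfl (by omega)))

theorem tripleCovered_foldedSeq_of_max {g : ℕ} (a b c : Fin (3 * g))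
    (hba : b.1 / 3 ≤ a.1 / 3) (hca : c.1 / 3 ≤ a.1 / 3) :
    TripleCovered (foldedSeq g) (2 * g + 1) a b c := by
  by_cases hab : a.1 % 3 = b.1 % 3
  · exact tripleCovered_foldedSeq_of_mod_eq a b c hab
  by_cases hac : a.1 % 3 = c.1 % 3
  · exact (tripleCovered_foldedSeq_of_mod_eq a c b hac).swap
  by_cases hbc : b.1 % 3 = c.1 % 3
  · exact (tripleCovered_foldedSeq_of_mod_eq b c a hbc).rotate.rotate
  by_cases hb : b.1 % 3 = (a.1 + 1) % 3
  · exact tripleCovered_foldedSeq_of_div_le a b c hb hca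
  · exact (tripleCovered_foldedSeq_of_div_le a c b (by omega) hba).swap

theorem isPCD_foldedSeq (g : ℕ) : IsPCD 3 (3 * g) (2 * g + 1) (foldedSeq g) := by
  refine ⟨fun a b c _ _ _ => ?_, singletonCond_foldedSeq g⟩
  change TripleCovered (foldedSeq g) (2 * g + 1) a b c
  rcases le_total (b.1 / 3) (a.1 / 3) with hba | hab
  · rcases le_total (c.1 / 3) (a.1 / 3) with hca | hac
    · exact tripleCovered_foldedSeq_of_max a b c hba hca
    · exact (tripleCovered_foldedSeq_of_max c a b hac (hba.trans hac)).rotate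
  · rcases le_total (c.1 / 3) (b.1 / 3) with hcb | hbc
    · exact (tripleCovered_foldedSeq_of_max b c a hcb hab).rotate.rotate
    · exact (tripleCovered_foldedSeq_of_max c a b (hab.trans hbc) hbc).rotate

theorem stmt_8 : ∀ ε : ℝ, 0 < ε → ∃ r ∈ gammaSet 3, (3 : ℝ) / 2 - ε < r := by
  intro ε hε
  obtain ⟨n, hn⟩ := exists_nat_gt (1 / ε)
  refine ⟨_, ⟨3 * (n + 2), 2 * (n + 2) + 1, foldedSeq (n + 2), by omega, by omega,
    isPCD_foldedSeq _, rfl⟩, ?_⟩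
  rw [div_lt_iff₀ hε] at hn
  push_cast
  rw [lt_div_iff₀ (by positivity)]
  linarith
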